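/- Let E > 0, −1 < ν < 1/2, and let 𝒞 be the isotropic map 𝒞(A) = (E/(1+ν))·(A + (ν/(1−2ν))·tr(A)·I). Let D ∈ Sym have ordered eigenvalues d₁ ≤ d₂ ≤ d₃ with corresponding orthonormal eigenvectors q₁, q₂, q₃, and set O₁₁ = q₁q₁ᵀ and O₂₂ = q₂q₂ᵀ. If d₂ + ν·d₃ ≤ 0 and d₃ ≥ 0, then Y* = (d₁ + ν·d₃)·O₁₁ + (d₂ + ν·d₃)·O₂₂ is the unique minimizer over Sym⁻ of Y ↦ (D−Y)•𝒞(D−Y). -/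

import Mathlib

open Matrix

/-- The Frobenius inner product `A • B = tr(Aᵀ B)` on 3×3 real matrices. -/
noncomputable def frob (A B : Matrix (Fin 3) (Fin 3) ℝ) : ℝ := (Aᵀ * B).trace

/-- Membership in the cone `Sym⁻` of negative semidefinite symmetric matrices. -/
def negSD (Y : Matrix (Fin 3) (Fin 3) ℝ) : Prop := Y.IsSymm ∧ (-Y).PosSemidef

/-- The isotropic tensor with Young's modulus `E` and Poisson's ratio `ν`:
`𝒞(A) = (E/(1+ν))·(A + (ν/(1−2ν))·tr(A)·I)`. -/
noncomputable def isoC (E ν : ℝ) (A : Matrix (Fin 3) (Fin 3) ℝ) :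
    Matrix (Fin 3) (Fin 3) ℝ :=
  (E / (1 + ν)) • (A + (ν / (1 - 2 * ν)) • A.trace • (1 : Matrix (Fin 3) (Fin 3) ℝ))

theorem sum_vecMulVec_self_eq_one_of_orthonormal {q₁ q₂ q₃ : Fin 3 → ℝ}
    (hn₁ : q₁ ⬝ᵥ q₁ = 1) (hn₂ : q₂ ⬝ᵥ q₂ = 1) (hn₃ : q₃ ⬝ᵥ q₃ = 1)
    (ho₁₂ : q₁ ⬝ᵥ q₂ = 0) (ho₁₃ : q₁ ⬝ᵥ q₃ = 0) (ho₂₃ : q₂ ⬝ᵥ q₃ = 0) :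
    vecMulVec q₁ q₁ + vecMulVec q₂ q₂ + vecMulVec q₃ q₃ = 1 := by
  have hQ : Matrix.of ![q₁, q₂, q₃] * (Matrix.of ![q₁, q₂, q₃])ᵀ = 1 := by
    ext i j
    have hij : (Matrix.of ![q₁, q₂, q₃] * (Matrix.of ![q₁, q₂, q₃])ᵀ) i j =
        ![q₁, q₂, q₃] i ⬝ᵥ ![q₁, q₂, q₃] j := rfl
    rw [hij]
    fin_cases i <;> fin_cases j <;>
      simp [hn₁, hn₂, hn₃, ho₁₂, ho₁₃, ho₂₃, dotProduct_comm q₂ q₁, dotProduct_comm q₃ q₁,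
        dotProduct_comm q₃ q₂]
  rw [← mul_eq_one_comm.mp hQ]
  ext i j
  simp [Matrix.mul_apply, Fin.sum_univ_three, vecMulVec_apply]

theorem frob_self_pos {Z : Matrix (Fin 3) (Fin 3) ℝ} (hZ : Z ≠ 0) : 0 < frob Z Z := by
  have h0 : 0 ≤ (Zᴴ * Z).trace := (posSemidef_conjTranspose_mul_self Z).trace_nonneg
  have h1 : (Zᴴ * Z).trace ≠ 0 := fun h => hZ (trace_conjTranspose_mul_self_eq_zero_iff.mp h)
  rw [conjTranspose_eq_transpose_of_trivial] at h0 h1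
  exact lt_of_le_of_ne h0 h1.symm

theorem trace_sq_le_three_mul_frob_self (Z : Matrix (Fin 3) (Fin 3) ℝ) :
    Z.trace ^ 2 ≤ 3 * frob Z Z := by
  simp only [frob, Matrix.trace, Matrix.diag, Matrix.mul_apply, Fin.sum_univ_three,
    transpose_apply]
  nlinarith [sq_nonneg (Z 0 0 - Z 1 1), sq_nonneg (Z 0 0 - Z 2 2), sq_nonneg (Z 1 1 - Z 2 2),
    sq_nonneg (Z 0 1), sq_nonneg (Z 0 2), sq_nonneg (Z 1 0), sq_nonneg (Z 1 2),
    sq_nonneg (Z 2 0), sq_nonneg (Z 2 1)]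

theorem frob_isoC (E ν : ℝ) (A B : Matrix (Fin 3) (Fin 3) ℝ) :
    frob A (isoC E ν B) =
      E / (1 + ν) * (frob A B + ν / (1 - 2 * ν) * (A.trace * B.trace)) := by
  simp only [frob, isoC, mul_add, mul_smul_comm, mul_one, trace_add, trace_smul, trace_transpose,
    smul_eq_mul]
  ring

theorem frob_isoC_self_pos {E ν : ℝ} (hE : 0 < E) (hν₁ : -1 < ν) (hν₂ : ν < 1 / 2)
    {Z : Matrix (Fin 3) (Fin 3) ℝ} (hZ : Z ≠ 0) : 0 < frob Z (isoC E ν Z) := by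
  have hF := frob_self_pos hZ
  have ht := trace_sq_le_three_mul_frob_self Z
  have h1 : 0 < 1 + ν := by linarith
  have h2 : 0 < 1 - 2 * ν := by linarith
  have key : 0 < (1 - 2 * ν) * frob Z Z + ν * Z.trace ^ 2 := by
    rcases le_or_gt 0 ν with hν | hν
    · positivity
    · nlinarith [mul_pos h1 hF, mul_nonneg (neg_nonneg.mpr hν.le) (sub_nonneg.mpr ht)]
  have h3 : frob Z (isoC E ν Z) =
      E / (1 + ν) * (((1 - 2 * ν) * frob Z Z + ν * Z.trace ^ 2) / (1 - 2 * ν)) := by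
    rw [frob_isoC, add_div, mul_div_cancel_left₀ _ h2.ne']
    ring
  rw [h3]
  positivity

theorem frob_comm (A B : Matrix (Fin 3) (Fin 3) ℝ) : frob A B = frob B A := by
  rw [frob, frob, ← trace_transpose, transpose_mul, transpose_transpose]

theorem frob_isoC_add_self (E ν : ℝ) (A B : Matrix (Fin 3) (Fin 3) ℝ) :
    frob (A + B) (isoC E ν (A + B)) =
      frob A (isoC E ν A) + 2 * frob B (isoC E ν A) + frob B (isoC E ν B) := by
  have h : frob (A + B) (A + B) = frob A A + 2 * frob B A + frob B B := by
    have hc := frob_comm A B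
    simp only [frob, transpose_add, add_mul, mul_add, trace_add] at hc ⊢
    linarith
  simp only [frob_isoC, h, trace_add]
  ring

theorem frob_vecMulVec_self (A : Matrix (Fin 3) (Fin 3) ℝ) (q : Fin 3 → ℝ) :
    frob A (vecMulVec q q) = q ⬝ᵥ (A *ᵥ q) := by
  rw [frob_comm, frob, transpose_vecMulVec, vecMulVec_mul, trace_vecMulVec, dotProduct_mulVec,
    dotProduct_comm]

theorem negSD.dotProduct_mulVec_nonpos {Y : Matrix (Fin 3) (Fin 3) ℝ} (hY : negSD Y)
    (q : Fin 3 → ℝ) : q ⬝ᵥ (Y *ᵥ q) ≤ 0 := by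
  have h := hY.2.dotProduct_mulVec_nonneg q
  simpa [neg_mulVec] using h

theorem negSD_smul_vecMulVec_add {a b : ℝ} (ha : a ≤ 0) (hb : b ≤ 0) (p q : Fin 3 → ℝ) :
    negSD (a • vecMulVec p p + b • vecMulVec q q) := by
  refine ⟨by simp [IsSymm, transpose_vecMulVec], ?_⟩
  have hp : (vecMulVec p p).PosSemidef := by simpa using posSemidef_vecMulVec_self_star p
  have hq : (vecMulVec q q).PosSemidef := by simpa using posSemidef_vecMulVec_self_star q
  have h := (hp.smul (neg_nonneg.mpr ha)).add (hq.smul (neg_nonneg.mpr hb))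
  rwa [neg_smul, neg_smul, ← neg_add] at h

/-- Isotropic case: if `d₂ + νd₃ ≤ 0` and `d₃ ≥ 0`, then
`Y* = (d₁ + νd₃)·q₁q₁ᵀ + (d₂ + νd₃)·q₂q₂ᵀ` is the unique minimizer over `Sym⁻` of
`Y ↦ (D−Y)•𝒞(D−Y)`. -/
theorem isoC_proj_rank_two_case (E ν : ℝ) (hE : 0 < E) (hν₁ : -1 < ν) (hν₂ : ν < 1 / 2)
    (D : Matrix (Fin 3) (Fin 3) ℝ) (hD : D.IsSymm)
    (d₁ d₂ d₃ : ℝ) (h12 : d₁ ≤ d₂) (h23 : d₂ ≤ d₃)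
    (q₁ q₂ q₃ : Fin 3 → ℝ)
    (hq₁ : D *ᵥ q₁ = d₁ • q₁) (hq₂ : D *ᵥ q₂ = d₂ • q₂) (hq₃ : D *ᵥ q₃ = d₃ • q₃)
    (hn₁ : q₁ ⬝ᵥ q₁ = 1) (hn₂ : q₂ ⬝ᵥ q₂ = 1) (hn₃ : q₃ ⬝ᵥ q₃ = 1)
    (ho₁₂ : q₁ ⬝ᵥ q₂ = 0) (ho₁₃ : q₁ ⬝ᵥ q₃ = 0) (ho₂₃ : q₂ ⬝ᵥ q₃ = 0)
    (hcase₁ : d₂ + ν * d₃ ≤ 0)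
    (hcase₂ : 0 ≤ d₃) :
    (negSD ((d₁ + ν * d₃) • vecMulVec q₁ q₁ + (d₂ + ν * d₃) • vecMulVec q₂ q₂) ∧
      ∀ Y : Matrix (Fin 3) (Fin 3) ℝ, negSD Y →
        frob (D - ((d₁ + ν * d₃) • vecMulVec q₁ q₁ + (d₂ + ν * d₃) • vecMulVec q₂ q₂))
            (isoC E ν
              (D - ((d₁ + ν * d₃) • vecMulVec q₁ q₁ + (d₂ + ν * d₃) • vecMulVec q₂ q₂))) ≤
          frob (D - Y) (isoC E ν (D - Y))) ∧
      ∀ Ystar : Matrix (Fin 3) (Fin 3) ℝ, negSD Ystar →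
        (∀ Y : Matrix (Fin 3) (Fin 3) ℝ, negSD Y →
          frob (D - Ystar) (isoC E ν (D - Ystar)) ≤ frob (D - Y) (isoC E ν (D - Y))) →
        Ystar = (d₁ + ν * d₃) • vecMulVec q₁ q₁ + (d₂ + ν * d₃) • vecMulVec q₂ q₂ := by
  set S := (d₁ + ν * d₃) • vecMulVec q₁ q₁ + (d₂ + ν * d₃) • vecMulVec q₂ q₂ with hS
  have hone := sum_vecMulVec_self_eq_one_of_orthonormal hn₁ hn₂ hn₃ ho₁₂ ho₁₃ ho₂₃
  have hDec : D = d₁ • vecMulVec q₁ q₁ + d₂ • vecMulVec q₂ q₂ + d₃ • vecMulVec q₃ q₃ := by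
    conv_lhs => rw [← mul_one D, ← hone]
    simp only [mul_add, mul_vecMulVec, hq₁, hq₂, hq₃, smul_vecMulVec]
  have hν₃ : 1 + ν ≠ 0 := by linarith
  have hν₄ : 1 - 2 * ν ≠ 0 := by linarith
  have htr : (D - S).trace = d₃ * (1 - 2 * ν) := by
    simp only [hDec, hS, trace_sub, trace_add, trace_smul, trace_vecMulVec, hn₁, hn₂, hn₃,
      smul_eq_mul]
    ring
  have hC : isoC E ν (D - S) = (E * d₃) • vecMulVec q₃ q₃ := by
    have hc : ν / (1 - 2 * ν) * (d₃ * (1 - 2 * ν)) = ν * d₃ := by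
      rw [mul_comm d₃, ← mul_assoc, div_mul_cancel₀ _ hν₄]
    have hd : E * d₃ = E / (1 + ν) * ((1 + ν) * d₃) := by field_simp
    rw [isoC, htr, smul_smul, hc, ← hone, hDec, hS, hd, mul_smul (E / (1 + ν))]
    congr 1
    module
  have hSq : q₃ ⬝ᵥ (S *ᵥ q₃) = 0 := by
    simp [hS, add_mulVec, smul_mulVec, vecMulVec_mulVec, ho₁₃, ho₂₃]
  have hlow : ∀ Y, negSD Y →
      frob (D - S) (isoC E ν (D - S)) + frob (S - Y) (isoC E ν (S - Y)) ≤
        frob (D - Y) (isoC E ν (D - Y)) := by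
    intro Y hY
    have hcross : 0 ≤ frob (S - Y) (isoC E ν (D - S)) := by
      have h : frob (S - Y) (isoC E ν (D - S)) = E * d₃ * -(q₃ ⬝ᵥ (Y *ᵥ q₃)) := by
        rw [hC, frob, mul_smul_comm, trace_smul, ← frob, frob_vecMulVec_self, sub_mulVec,
          dotProduct_sub, hSq, zero_sub, smul_eq_mul]
      rw [h]
      exact mul_nonneg (mul_nonneg hE.le hcase₂) (neg_nonneg.mpr (hY.dotProduct_mulVec_nonpos q₃))
    rw [← sub_add_sub_cancel D S Y, frob_isoC_add_self]
    linarith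
  have hSneg : negSD S := negSD_smul_vecMulVec_add (by linarith) hcase₁ q₁ q₂
  refine ⟨⟨hSneg, fun Y hY => ?_⟩, fun Y hY hmin => ?_⟩
  · rcases eq_or_ne (S - Y) 0 with h | h
    · rw [sub_eq_zero.mp h]
    · linarith [hlow Y hY, frob_isoC_self_pos hE hν₁ hν₂ h]
  · by_contra hne
    have h : S - Y ≠ 0 := sub_ne_zero.mpr (Ne.symm hne)
    linarith [hlow Y hY, hmin S hSneg, frob_isoC_self_pos hE hν₁ hν₂ h]
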